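/- arXiv:2407.18508 — 2 statements merged into one kernel-verified Lean document; each statement's English description precedes it below -/
import Mathlib

section
/- Under the dispersion assumptions (with dispersion ω(k) = Ω(|k|)), if the origin 0 belongs to the interior of 𝒮 ⊆ ℝ³, then the collisional region satisfies Coll[𝒮] = ℝ³ \ {0}. -/
open MeasureTheory Set Filter

/-- Dispersion assumptions on the profile `Ω` of the dispersion relation
`ω(k) = Ω(|k|)`, together with its inverse `r = Ω⁻¹` and the auxiliary
function `℧(ρ) = ρ / Ω'(ρ)` (named `U` here). -/
structure Dispersion where
  Ω : ℝ → ℝ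
  Ω_zero : Ω 0 = 0
  Ω_smooth : ContDiffOn ℝ 1 Ω (Set.Ici 0)
  Ω_strictMono : StrictMonoOn Ω (Set.Ici 0)
  Ω_convex : ConvexOn ℝ (Set.Ici 0) Ω
  Ω_bij : Set.BijOn Ω (Set.Ici 0) (Set.Ici 0)
  r : ℝ → ℝ
  r_nonneg : ∀ x, 0 ≤ x → 0 ≤ r x
  r_left : ∀ ρ, 0 ≤ ρ → r (Ω ρ) = ρ
  r_right : ∀ x, 0 ≤ x → Ω (r x) = x
  U : ℝ → ℝ
  U_def : ∀ ρ, 0 < ρ → U ρ = ρ / derivWithin Ω (Set.Ici 0) ρ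
  U_mono : MonotoneOn U (Set.Ioi 0)
  CU : ℝ
  iota : ℝ
  CU_nonneg : 0 ≤ CU
  iota_nonneg : 0 ≤ iota
  iota_le_one : iota ≤ 1
  U_bound : ∀ ρ, 0 < ρ → U ρ ≤ CU * ρ ^ iota
  α : ℝ
  α' : ℝ
  Cω : ℝ
  Cω' : ℝ
  α_gt_one : 1 < α
  α_le_two : α ≤ 2
  α'_gt_one : 1 < α'
  α'_le_α : α' ≤ α
  Cω_pos : 0 < Cω
  Cω'_pos : 0 < Cω'
  Ω_lower : ∀ ρ, 0 ≤ ρ → Cω * ρ ^ α ≤ Ω ρ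
  Ω_upper : ∀ ρ, 0 ≤ ρ → ρ < 1 → Ω ρ ≤ Cω' * ρ ^ α'

/-- The collision kernel `𝒦(ω,ω₁,ω₂)` of the reduced 4-wave kinetic equation. -/
noncomputable def kernel (D : Dispersion) (ω ω₁ ω₂ : ℝ) : ℝ :=
  D.U (D.r (ω + ω₁ - ω₂)) *
    min (min (D.r ω) (D.r ω₁)) (min (D.r ω₂) (D.r (ω + ω₁ - ω₂))) /
      (D.r ω * D.r ω₁ * D.r ω₂)

/-- `g : [0,∞) → L¹((0,∞))` is `C¹`: there is a time derivative `dg`, integrable in `ω`,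
which is the derivative of `g` in the `L¹` sense, and which depends `L¹`-continuously
on time. -/
def C1inL1 (g : ℝ → ℝ → ℝ) : Prop :=
  ∃ dg : ℝ → ℝ → ℝ,
    (∀ t, 0 ≤ t → MeasureTheory.IntegrableOn (dg t) (Set.Ioi 0)) ∧
    (∀ t, 0 ≤ t → Filter.Tendsto
      (fun h : ℝ => ∫ ω in Set.Ioi (0:ℝ), |g (t + h) ω - g t ω - h * dg t ω| / |h|)
      (nhdsWithin 0 {(0:ℝ)}ᶜ) (nhds 0)) ∧
    (∀ t, 0 ≤ t → Filter.Tendsto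
      (fun s : ℝ => ∫ ω in Set.Ioi (0:ℝ), |dg s ω - dg t ω|) (nhds t) (nhds 0))

/-- A nonnegative `g ∈ C¹([0,∞); L¹((0,∞)))` is a global weak solution of the reduced
4-wave kinetic equation with collision constant `CQ` if the weak formulation holds for
every `C²` compactly supported test function. -/
def IsWeakSolution (D : Dispersion) (CQ : ℝ) (g : ℝ → ℝ → ℝ) : Prop :=
  (∀ t, 0 ≤ t → ∀ ω, 0 < ω → 0 ≤ g t ω) ∧
  (∀ t, 0 ≤ t → MeasureTheory.IntegrableOn (g t) (Set.Ioi 0)) ∧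
  C1inL1 g ∧
  ∀ φ : ℝ → ℝ, ContDiff ℝ 2 φ → HasCompactSupport φ → ∀ t, 0 ≤ t →
    (∫ ω in Set.Ioi (0:ℝ), g t ω * φ ω) - (∫ ω in Set.Ioi (0:ℝ), g 0 ω * φ ω) =
      CQ * ∫ s in (0:ℝ)..t, ∫ ω in Set.Ioi (0:ℝ), ∫ ω₁ in Set.Ioi (0:ℝ),
        ∫ ω₂ in Set.Ioi (0:ℝ),
          g s ω * g s ω₁ * g s ω₂ * kernel D ω ω₁ ω₂ *
            (φ ω₂ + φ (ω + ω₁ - ω₂) - φ ω - φ ω₁) *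
            (if ω₂ ≤ ω + ω₁ then (1:ℝ) else 0)

open Set

/-- One step of the collision process: points reachable from `S` by one resonant
4-wave interaction (with the origin removed). -/
def collStep (ω : EuclideanSpace ℝ (Fin 3) → ℝ) (S : Set (EuclideanSpace ℝ (Fin 3))) :
    Set (EuclideanSpace ℝ (Fin 3)) :=
  {k | ∃ k₁ ∈ S, ∃ k₂ ∈ S, ∃ k₃ ∈ S,
      k = k₁ + k₂ - k₃ ∧ ω k = ω k₁ + ω k₂ - ω k₃ ∧ k₁ + k₂ ≠ 0} \ {0}

/-- The iterated collision sets `𝒮ₙ[𝒮]`. -/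
def collSet (ω : EuclideanSpace ℝ (Fin 3) → ℝ) (S : Set (EuclideanSpace ℝ (Fin 3))) :
    ℕ → Set (EuclideanSpace ℝ (Fin 3))
  | 0 => S \ {0}
  | n + 1 => collStep ω (collSet ω S n)

/-- The collisional region `Coll[𝒮] = ⋃ₙ 𝒮ₙ[𝒮]`. -/
def Coll (ω : EuclideanSpace ℝ (Fin 3) → ℝ) (S : Set (EuclideanSpace ℝ (Fin 3))) :
    Set (EuclideanSpace ℝ (Fin 3)) :=
  ⋃ n : ℕ, collSet ω S n

theorem exists_norm_eq_one_inner_eq_zero (k : EuclideanSpace ℝ (Fin 3)) (hk : k ≠ 0) :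
    ∃ e : EuclideanSpace ℝ (Fin 3), ‖e‖ = 1 ∧ inner ℝ k e = 0 := by
  have : Fact (Module.finrank ℝ (EuclideanSpace ℝ (Fin 3)) = 2 + 1) := ⟨by simp⟩
  have hfin := Submodule.finrank_orthogonal_span_singleton (𝕜 := ℝ) (n := 2) hk
  have hne : (Submodule.span ℝ {k})ᗮ ≠ ⊥ := by
    intro h
    rw [h, finrank_bot] at hfin
    omega
  obtain ⟨v, hv, hv0⟩ := Submodule.exists_mem_ne_zero_of_ne_bot hne
  refine ⟨‖v‖⁻¹ • v, norm_smul_inv_norm hv0, ?_⟩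
  rw [inner_smul_right, Submodule.mem_orthogonal_singleton_iff_inner_right.mp hv, mul_zero]

/-- If `a` is at least half the norm of `p ≠ 0`, then `p` is a sum of two vectors of norm `a`. -/
theorem exists_add_eq_of_norm_le (p : EuclideanSpace ℝ (Fin 3)) (hp : p ≠ 0) (a : ℝ)
    (ha : ‖p‖ / 2 ≤ a) :
    ∃ k₁ k₂ : EuclideanSpace ℝ (Fin 3), k₁ + k₂ = p ∧ ‖k₁‖ = a ∧ ‖k₂‖ = a := by
  obtain ⟨e, he, hpe⟩ := exists_norm_eq_one_inner_eq_zero p hp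
  have ha0 : 0 ≤ a := le_trans (by positivity) ha
  have hs : 0 ≤ a ^ 2 - (‖p‖ / 2) ^ 2 := by
    have := pow_le_pow_left₀ (by positivity) ha 2
    linarith
  set s := √(a ^ 2 - (‖p‖ / 2) ^ 2) with hs_def
  have hnorm : ∀ t : ℝ, t ^ 2 = s ^ 2 → ‖(2⁻¹ : ℝ) • p + t • e‖ = a := by
    intro t ht
    rw [← sq_eq_sq₀ (norm_nonneg _) ha0, norm_add_sq_real, inner_smul_left, inner_smul_right,
      hpe, norm_smul, norm_smul, he, mul_one, Real.norm_eq_abs t, sq_abs, ht, hs_def,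
      Real.sq_sqrt hs, Real.norm_eq_abs, abs_of_pos (by norm_num : (0 : ℝ) < 2⁻¹)]
    ring
  refine ⟨(2⁻¹ : ℝ) • p + s • e, (2⁻¹ : ℝ) • p + (-s) • e, ?_, hnorm s rfl, hnorm (-s) (by ring)⟩
  module

theorem Dispersion.Ω_pos (D : Dispersion) {ρ : ℝ} (hρ : 0 < ρ) : 0 < D.Ω ρ := by
  simpa [D.Ω_zero] using D.Ω_strictMono self_mem_Ici hρ.le hρ

theorem Dispersion.r_pos (D : Dispersion) {x : ℝ} (hx : 0 < x) : 0 < D.r x := by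
  refine (D.r_nonneg x hx.le).lt_of_ne fun h => ?_
  have := D.r_right x hx.le
  rw [← h, D.Ω_zero] at this
  exact hx.ne this

theorem Dispersion.Ω_midpoint_le (D : Dispersion) {ρ σ : ℝ} (hρ : 0 ≤ ρ) (hσ : 0 ≤ σ) :
    D.Ω ((ρ + σ) / 2) ≤ (D.Ω ρ + D.Ω σ) / 2 := by
  have h := D.Ω_convex.2 (mem_Ici.mpr hρ) (mem_Ici.mpr hσ) (by norm_num : (0 : ℝ) ≤ 1 / 2)
    (by norm_num : (0 : ℝ) ≤ 1 / 2) (by norm_num)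
  simp only [smul_eq_mul] at h
  rw [show (ρ + σ) / 2 = 1 / 2 * ρ + 1 / 2 * σ by ring]
  linarith

/-- One collision step enlarges a punctured sublevel set of the dispersion relation by the
factor `3 / 2`. -/
theorem mem_collStep_of_sublevel_subset (D : Dispersion) (T : Set (EuclideanSpace ℝ (Fin 3)))
    {X : ℝ} (hX : 0 < X) (hT : ∀ k : EuclideanSpace ℝ (Fin 3), k ≠ 0 → D.Ω ‖k‖ < X → k ∈ T)
    (k : EuclideanSpace ℝ (Fin 3)) (hk : k ≠ 0) (hkX : D.Ω ‖k‖ < 3 / 2 * X) :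
    k ∈ collStep (fun k => D.Ω ‖k‖) T := by
  have hk' : 0 < ‖k‖ := norm_pos_iff.mpr hk
  have hδ : 0 < D.r (X / 4) := D.r_pos (by positivity)
  have ht : 0 < D.r (X / 4) / ‖k‖ := by positivity
  set t := D.r (X / 4) / ‖k‖ with ht_def
  have hk₃ : ‖t • k‖ = D.r (X / 4) := by
    rw [norm_smul, Real.norm_of_nonneg ht.le, ht_def, div_mul_cancel₀ _ hk'.ne']
  have hΩ₃ : D.Ω ‖t • k‖ = X / 4 := by rw [hk₃, D.r_right _ (by positivity)]
  have hp : k + t • k ≠ 0 := by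
    rw [show k + t • k = (1 + t) • k by module]
    exact smul_ne_zero (by positivity) hk
  have hE : 0 < (D.Ω ‖k‖ + D.Ω ‖t • k‖) / 2 := by
    have := D.Ω_pos hk'
    rw [hΩ₃]
    positivity
  have ha := D.r_pos hE
  have hΩa := D.r_right _ hE.le
  set a := D.r ((D.Ω ‖k‖ + D.Ω ‖t • k‖) / 2)
  have hpa : ‖k + t • k‖ / 2 ≤ a := by
    have hle : (‖k‖ + ‖t • k‖) / 2 ≤ a := by
      rw [← D.Ω_strictMono.le_iff_le (mem_Ici.mpr (by positivity)) (mem_Ici.mpr ha.le), hΩa]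
      exact D.Ω_midpoint_le (norm_nonneg _) (norm_nonneg _)
    linarith [norm_add_le k (t • k)]
  obtain ⟨k₁, k₂, hsum, h₁, h₂⟩ := exists_add_eq_of_norm_le _ hp a hpa
  have hmem : ∀ q : EuclideanSpace ℝ (Fin 3), ‖q‖ = a → q ∈ T := by
    intro q hq
    refine hT q (norm_pos_iff.mp (hq ▸ ha)) ?_
    rw [hq, hΩa, hΩ₃]
    linarith
  refine ⟨⟨k₁, hmem k₁ h₁, k₂, hmem k₂ h₂, t • k, hT _ (smul_ne_zero ht.ne' hk) ?_, ?_, ?_, ?_⟩, hk⟩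
  · rw [hΩ₃]
    linarith
  · rw [hsum, add_sub_cancel_right]
  · simp only [h₁, h₂, hΩa]
    ring
  · rwa [hsum]

theorem mem_collSet_of_lt (D : Dispersion) (S : Set (EuclideanSpace ℝ (Fin 3))) {X : ℝ}
    (hX : 0 < X) (hS : ∀ k : EuclideanSpace ℝ (Fin 3), D.Ω ‖k‖ < X → k ∈ S) (n : ℕ) :
    ∀ k : EuclideanSpace ℝ (Fin 3), k ≠ 0 → D.Ω ‖k‖ < (3 / 2) ^ n * X →
      k ∈ collSet (fun k => D.Ω ‖k‖) S n := by
  induction n with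
  | zero => exact fun k hk hkX => ⟨hS k (by simpa using hkX), hk⟩
  | succ n ih =>
    intro k hk hkX
    refine mem_collStep_of_sublevel_subset D _ (by positivity) ih k hk ?_
    rwa [← mul_assoc, ← pow_succ']

theorem zero_notMem_collSet (ω : EuclideanSpace ℝ (Fin 3) → ℝ)
    (S : Set (EuclideanSpace ℝ (Fin 3))) (n : ℕ) : 0 ∉ collSet ω S n := by
  cases n <;> exact fun h => h.2 rfl

/-- Under the dispersion assumptions, with dispersion
`ω(k) = Ω(|k|)`, if the origin belongs to the interior of `𝒮 ⊆ ℝ³` then the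
collisional region is all of `ℝ³ \ {0}`. -/
theorem coll_region_general (D : Dispersion) (S : Set (EuclideanSpace ℝ (Fin 3)))
    (hS : (0 : EuclideanSpace ℝ (Fin 3)) ∈ interior S) :
    Coll (fun k => D.Ω ‖k‖) S = {(0 : EuclideanSpace ℝ (Fin 3))}ᶜ := by
  refine Subset.antisymm ?_ fun k hk => ?_
  · rintro k hk rfl
    obtain ⟨n, hn⟩ := mem_iUnion.mp hk
    exact zero_notMem_collSet _ _ n hn
  · obtain ⟨ε, hε, hball⟩ := Metric.mem_nhds_iff.mp (mem_interior_iff_mem_nhds.mp hS)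
    have hX := D.Ω_pos hε
    obtain ⟨n, hn⟩ := pow_unbounded_of_one_lt (D.Ω ‖k‖ / D.Ω ε) (by norm_num : (1 : ℝ) < 3 / 2)
    refine mem_iUnion.mpr ⟨n, mem_collSet_of_lt D S hX (fun q hq => hball ?_) n k hk ?_⟩
    · rw [mem_ball_zero_iff]
      exact (D.Ω_strictMono.lt_iff_lt (norm_nonneg q) hε.le).mp hq
    · exact (div_lt_iff₀ hX).mp hn
end

section
/- Under the dispersion assumptions, let g : (0,∞) → [0,∞) be measurable and let φ ∈ C²([0,∞)) be convex with compact support, and assume the function (ω,ω₁,ω₂) ↦ g(ω)g(ω₁)g(ω₂) 𝒦(ω,ω₁,ω₂) [φ(ω₂) + φ(ω+ω₁−ω₂) − φ(ω) − φ(ω₁)] 𝟙_{ω+ω₁ ≥ ω₂} is absolutely integrable on (0,∞)³. Then ∫∫∫_{(0,∞)³} g(ω)g(ω₁)g(ω₂) 𝒦(ω,ω₁,ω₂) [φ(ω₂) + φ(ω+ω₁−ω₂) − φ(ω) − φ(ω₁)] 𝟙_{ω+ω₁ ≥ ω₂} dω dω₁ dω₂ ≥ 0. (This expresses that ∫_{ℝ³}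 Q[f](k) φ(ω(k)) dk ≥ 0 for every convex compactly supported test function φ and every nonnegative radial f.) -/
open MeasureTheory Set Filter

namespace Dispersion

variable (D : Dispersion)

theorem r_pos_s5 {x : ℝ} (hx : 0 < x) : 0 < D.r x := by
  refine (D.r_nonneg x hx.le).lt_of_ne fun h => ?_
  have := D.r_right x hx.le
  rw [← h, D.Ω_zero] at this
  exact hx.ne this

theorem r_mono {x y : ℝ} (hx : 0 ≤ x) (hxy : x ≤ y) : D.r x ≤ D.r y := by
  by_contra! h
  have := D.Ω_strictMono (D.r_nonneg y (hx.trans hxy)) (D.r_nonneg x hx) h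
  rw [D.r_right x hx, D.r_right y (hx.trans hxy)] at this
  exact this.not_ge hxy

theorem r_zero : D.r 0 = 0 := by
  simpa [D.Ω_zero] using D.r_left 0 le_rfl

theorem U_nonneg {ρ : ℝ} (hρ : 0 < ρ) : 0 ≤ D.U ρ := by
  rw [D.U_def ρ hρ]
  exact div_nonneg hρ.le D.Ω_strictMono.monotoneOn.derivWithin_nonneg

theorem U_r_mono {x y : ℝ} (hx : 0 < x) (hxy : x ≤ y) : D.U (D.r x) ≤ D.U (D.r y) :=
  D.U_mono (D.r_pos_s5 hx) (D.r_pos_s5 (hx.trans_le hxy)) (D.r_mono hx.le hxy)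

end Dispersion

theorem kernel_comm (D : Dispersion) (x y z : ℝ) : kernel D x y z = kernel D y x z := by
  simp only [kernel]
  rw [add_comm x y, min_comm (D.r x), mul_comm (D.r x)]

theorem kernel_nonneg (D : Dispersion) {x y z : ℝ} (hx : 0 < x) (hy : 0 < y) (hz : 0 < z)
    (h : z ≤ x + y) : 0 ≤ kernel D x y z := by
  have hrx := D.r_pos_s5 hx
  have hry := D.r_pos_s5 hy
  have hrz := D.r_pos_s5 hz
  simp only [kernel]
  rcases (sub_nonneg.2 h).eq_or_lt with h0 | h0
  · rw [← h0, D.r_zero, min_eq_right hrz.le, min_eq_right (le_min hrx.le hry.le)]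
    simp
  · have hrw := D.r_pos_s5 h0
    have := D.U_nonneg hrw
    positivity

/-- A convex function increases when two points are spread apart symmetrically. -/
theorem ConvexOn.add_le_add_of_mem_Icc {s : Set ℝ} {φ : ℝ → ℝ} (hφ : ConvexOn ℝ s φ) {p q t : ℝ}
    (hp : p ∈ s) (hq : q ∈ s) (ht : t ∈ Icc p q) : φ t + φ (p + q - t) ≤ φ p + φ q := by
  rw [← segment_eq_Icc (ht.1.trans ht.2)] at ht
  obtain ⟨u, v, hu, hv, huv, rfl⟩ := ht
  have h₁ := hφ.2 hp hq hu hv huv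
  have h₂ := hφ.2 hp hq hv hu (by linarith)
  have : p + q - (u • p + v • q) = v • p + u • q := by
    simp only [smul_eq_mul]
    linear_combination (p + q) * (-huv)
  rw [this]
  simp only [smul_eq_mul] at h₁ h₂ ⊢
  have h₃ : (u + v) * (φ p + φ q) = φ p + φ q := by rw [huv, one_mul]
  linarith

/-- The collision integrand without the density factors. -/
noncomputable def collisionWeight (D : Dispersion) (φ : ℝ → ℝ) (x y z : ℝ) : ℝ :=
  kernel D x y z * (φ z + φ (x + y - z) - φ x - φ y) * (if z ≤ x + y then (1 : ℝ) else 0)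

theorem collisionWeight_comm (D : Dispersion) (φ : ℝ → ℝ) (x y z : ℝ) :
    collisionWeight D φ x y z = collisionWeight D φ y x z := by
  simp only [collisionWeight, kernel_comm D x y, add_comm x y]
  ring

theorem collisionWeight_cyclic_sum_nonneg_of_le {D : Dispersion} {φ : ℝ → ℝ}
    (hφ : ConvexOn ℝ (Ici 0) φ) {a b c : ℝ} (ha : 0 < a)
    (hab : a ≤ b) (hbc : b ≤ c) :
    0 ≤ collisionWeight D φ a b c + collisionWeight D φ b c a + collisionWeight D φ c a b := by
  have hb := ha.trans_le hab
  have hc := hb.trans_le hbc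
  have hra := D.r_pos_s5 ha
  have hrb := D.r_pos_s5 hb
  have hrc := D.r_pos_s5 hc
  have h₁ : 0 ≤ collisionWeight D φ a b c := by
    simp only [collisionWeight]
    split_ifs with h
    · have hbr := hφ.add_le_add_of_mem_Icc (p := a + b - c) (q := c) (t := a)
        (sub_nonneg.2 h) hc.le ⟨by linarith, hab.trans hbc⟩
      rw [show a + b - c + c - a = b by ring] at hbr
      have := kernel_nonneg D ha hb hc h
      exact mul_nonneg (mul_nonneg this (by linarith)) zero_le_one
    · simp
  have hspread := hφ.add_le_add_of_mem_Icc (p := a) (q := b + c - a) (t := b)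
    ha.le (by simp only [mem_Ici]; linarith) ⟨hab, by linarith⟩
  rw [show a + (b + c - a) - b = c by ring] at hspread
  have hmid := hφ.add_le_add_of_mem_Icc (p := c + a - b) (q := b + c - a) (t := c)
    (by simp only [mem_Ici]; linarith) (by simp only [mem_Ici]; linarith)
    ⟨by linarith, by linarith⟩
  rw [show c + a - b + (b + c - a) - c = c by ring] at hmid
  have hU := D.U_r_mono (x := c + a - b) (y := b + c - a) (by linarith) (by linarith)
  have hU0 := D.U_nonneg (D.r_pos_s5 (x := c + a - b) (by linarith))
  have hkey : 0 ≤ D.U (D.r (b + c - a)) * (φ a + φ (b + c - a) - φ b - φ c) +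
      D.U (D.r (c + a - b)) * (φ b + φ (c + a - b) - φ c - φ a) := by
    have e₁ := mul_nonneg (sub_nonneg.2 hU)
      (show 0 ≤ φ a + φ (b + c - a) - φ b - φ c by linarith)
    have e₂ := mul_nonneg hU0 (show 0 ≤ φ (b + c - a) + φ (c + a - b) - 2 * φ c by linarith)
    linarith
  have hrab := D.r_mono ha.le hab
  have hrac := D.r_mono ha.le (hab.trans hbc)
  have hraw₁ := D.r_mono (y := b + c - a) ha.le (by linarith)
  have hraw₂ := D.r_mono (y := c + a - b) ha.le (by linarith)
  have hmin₁ : min (min (D.r b) (D.r c)) (min (D.r a) (D.r (b + c - a))) = D.r a := by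
    rw [min_eq_left hraw₁, min_eq_right (le_min hrab hrac)]
  have hmin₂ : min (min (D.r c) (D.r a)) (min (D.r b) (D.r (c + a - b))) = D.r a := by
    rw [min_eq_right hrac, min_eq_left (le_min hrab hraw₂)]
  have h₂ : collisionWeight D φ b c a + collisionWeight D φ c a b =
      D.r a / (D.r a * D.r b * D.r c) *
        (D.U (D.r (b + c - a)) * (φ a + φ (b + c - a) - φ b - φ c) +
          D.U (D.r (c + a - b)) * (φ b + φ (c + a - b) - φ c - φ a)) := by
    simp only [collisionWeight, kernel, hmin₁, hmin₂]
    rw [if_pos (by linarith), if_pos (by linarith)]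
    ring
  have h₃ : 0 ≤ D.r a / (D.r a * D.r b * D.r c) := by positivity
  rw [add_assoc, h₂]
  exact add_nonneg h₁ (mul_nonneg h₃ hkey)

theorem collisionWeight_cyclic_sum_nonneg {D : Dispersion} {φ : ℝ → ℝ}
    (hφ : ConvexOn ℝ (Ici 0) φ) {x y z : ℝ} (hx : 0 < x) (hy : 0 < y)
    (hz : 0 < z) :
    0 ≤ collisionWeight D φ x y z + collisionWeight D φ y z x + collisionWeight D φ z x y := by
  have key := @collisionWeight_cyclic_sum_nonneg_of_le D φ hφ
  have hxy := collisionWeight_comm D φ x y z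
  have hyz := collisionWeight_comm D φ y z x
  have hzx := collisionWeight_comm D φ z x y
  rcases le_total x y with h₁ | h₁ <;> rcases le_total y z with h₂ | h₂ <;>
    rcases le_total x z with h₃ | h₃
  · linarith [key hx h₁ h₂]
  · linarith [key hx h₁ h₂]
  · linarith [key hx h₃ h₂]
  · linarith [key hz h₃ h₁]
  · linarith [key hy h₁ h₃]
  · linarith [key hy h₂ h₃]
  · linarith [key hz h₂ h₁]
  · linarith [key hz h₂ h₁]

/-- The cyclic shift of the three coordinates preserves Lebesgue measure. -/
theorem measurePreserving_cyclicShift :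
    MeasurePreserving
      (MeasurableEquiv.prodComm.trans MeasurableEquiv.prodAssoc : ℝ × ℝ × ℝ ≃ᵐ ℝ × ℝ × ℝ) :=
  (volume_preserving_prodAssoc (α₁ := ℝ) (β₁ := ℝ) (γ₁ := ℝ)).comp Measure.measurePreserving_swap

theorem setIntegral_nonneg_of_cyclic_sum_nonneg {s : Set ℝ} (hs : MeasurableSet s)
    {F : ℝ × ℝ × ℝ → ℝ} (hF : IntegrableOn F (s ×ˢ s ×ˢ s))
    (hsum : ∀ x ∈ s, ∀ y ∈ s, ∀ z ∈ s, 0 ≤ F (x, y, z) + F (y, z, x) + F (z, x, y)) :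
    0 ≤ ∫ p in s ×ˢ s ×ˢ s, F p := by
  set S := s ×ˢ s ×ˢ s with hS
  let σ : ℝ × ℝ × ℝ ≃ᵐ ℝ × ℝ × ℝ := MeasurableEquiv.prodComm.trans MeasurableEquiv.prodAssoc
  have hσ : MeasurePreserving σ := measurePreserving_cyclicShift
  have hpre : σ ⁻¹' S = S := by
    ext ⟨x, y, z⟩
    change (y ∈ s ∧ z ∈ s ∧ x ∈ s) ↔ (x ∈ s ∧ y ∈ s ∧ z ∈ s)
    tauto
  have hint (f : ℝ × ℝ × ℝ → ℝ) (hf : IntegrableOn f S) : IntegrableOn (f ∘ σ) S := by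
    have := (hσ.integrableOn_comp_preimage σ.measurableEmbedding).2 hf
    rwa [hpre] at this
  have heq (f : ℝ × ℝ × ℝ → ℝ) : ∫ p in S, (f ∘ σ) p = ∫ p in S, f p := by
    have := hσ.setIntegral_preimage_emb σ.measurableEmbedding f S
    rwa [hpre] at this
  have hF₁ := hint F hF
  have hF₂ := hint (F ∘ σ) hF₁
  have h : 0 ≤ ∫ p in S, (F p + (F ∘ σ) p + ((F ∘ σ) ∘ σ) p) :=
    setIntegral_nonneg (hs.prod (hs.prod hs)) fun ⟨x, y, z⟩ hp =>
      hsum x hp.1 y hp.2.1 z hp.2.2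
  have hadd : ∫ p in S, (F p + (F ∘ σ) p + ((F ∘ σ) ∘ σ) p) =
      (∫ p in S, F p) + (∫ p in S, (F ∘ σ) p) + ∫ p in S, ((F ∘ σ) ∘ σ) p := by
    rw [← integral_add hF hF₁]
    exact integral_add (hF.add hF₁) hF₂
  rw [hadd, heq, heq, heq] at h
  linarith

/-- Under the dispersion assumptions, for every nonnegative
measurable `g` on `(0,∞)` and every convex, compactly supported `C²` test function
`φ` on `[0,∞)`, if the collision integrand is absolutely integrable on `(0,∞)³`,
then the collision integral tested against `φ` is nonnegative. -/
theorem collision_integral_nonneg_convex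
    (D : Dispersion) (g : ℝ → ℝ) (hgmeas : Measurable g)
    (hgnonneg : ∀ ω, 0 < ω → 0 ≤ g ω)
    (φ : ℝ → ℝ) (hφsmooth : ContDiffOn ℝ 2 φ (Set.Ici 0))
    (hφconv : ConvexOn ℝ (Set.Ici 0) φ) (hφsupp : HasCompactSupport φ)
    (hint : MeasureTheory.IntegrableOn
      (fun p : ℝ × ℝ × ℝ =>
        g p.1 * g p.2.1 * g p.2.2 * kernel D p.1 p.2.1 p.2.2 *
          (φ p.2.2 + φ (p.1 + p.2.1 - p.2.2) - φ p.1 - φ p.2.1) *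
          (if p.2.2 ≤ p.1 + p.2.1 then (1:ℝ) else 0))
      (Set.Ioi 0 ×ˢ Set.Ioi 0 ×ˢ Set.Ioi 0)) :
    0 ≤ ∫ p in (Set.Ioi (0:ℝ) ×ˢ Set.Ioi (0:ℝ) ×ˢ Set.Ioi (0:ℝ)),
        g p.1 * g p.2.1 * g p.2.2 * kernel D p.1 p.2.1 p.2.2 *
          (φ p.2.2 + φ (p.1 + p.2.1 - p.2.2) - φ p.1 - φ p.2.1) *
          (if p.2.2 ≤ p.1 + p.2.1 then (1:ℝ) else 0) := by
  refine setIntegral_nonneg_of_cyclic_sum_nonneg measurableSet_Ioi hint fun x hx y hy z hz => ?_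
  have hg := mul_nonneg (mul_nonneg (hgnonneg x hx) (hgnonneg y hy)) (hgnonneg z hz)
  have h := mul_nonneg hg (collisionWeight_cyclic_sum_nonneg (D := D) hφconv hx hy hz)
  simp only [collisionWeight] at h
  refine h.trans_eq ?_
  dsimp only
  ring
end
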